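/- Let n ≥ 1, x ∈ ℝ^n with x_i ≥ 0 for all i, and q ∈ {1,…,n}. Then for every d ∈ ℝ^n with 0 ≤ d_i ≤ 1 for all i and Σ_{i=1}^n d_i = n−q, one has (n−q)·x_(q) + Σ_{i=1}^n max(x_i − x_(q), 0) ≥ Σ_{i=1}^n d_i·x_i, where x_(q) is the q-th order statistic of x. (In the k-sum formulation this says that the inequality (n−q)t + Σ_i v_i ≥ Σ_i d_i s_i is valid at the optimal dual solution t = x_(q), v_i = max(x_i − x_(q), 0).) -/

import Mathlib

open Finset

/-- The quantile (pinball) loss `ρ_τ(u)`: `τ*u` if `u ≥ 0`, `(τ-1)*u` if `u < 0`. -/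
noncomputable def pinball (τ u : ℝ) : ℝ := if 0 ≤ u then τ * u else (τ - 1) * u

/-- The `τ` sample quantile function `L_τ(y, γ) = ∑ i, ρ_τ (y i - γ)`. -/
noncomputable def sampleQuantileFn {n : ℕ} (τ : ℝ) (y : Fin n → ℝ) (γ : ℝ) : ℝ :=
  ∑ i, pinball τ (y i - γ)

/-- `orderStat y i` is the `(i+1)`-th smallest entry of `y` (i.e. the `(i+1)`-th
order statistic, with 0-indexed `i : Fin n`). -/
noncomputable def orderStat {n : ℕ} (y : Fin n → ℝ) (i : Fin n) : ℝ :=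
  y (Tuple.sort y i)

/-- The `k`-sum operator `S_k(y)`: the sum of the `n - k + 1` largest entries of `y`,
i.e. the sum of the order statistics in (1-indexed) positions `k, …, n`. -/
noncomputable def ksum {n : ℕ} (y : Fin n → ℝ) (k : ℕ) : ℝ :=
  ∑ i ∈ Finset.univ.filter (fun i : Fin n => k ≤ (i : ℕ) + 1), orderStat y i

/-- for nonnegative `x` and `d ∈ [0,1]ⁿ` with `Σ d_i = n − q`,
`(n−q)·x_(q) + Σ max(x_i − x_(q), 0) ≥ Σ d_i·x_i`. -/
theorem stmt_12 (n : ℕ) (hn : 1 ≤ n) (x : Fin n → ℝ) (hx : ∀ i, 0 ≤ x i)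
    (q : ℕ) (hq1 : 1 ≤ q) (hq2 : q ≤ n) (d : Fin n → ℝ)
    (hd : ∀ i, 0 ≤ d i ∧ d i ≤ 1) (hsum : (∑ i, d i) = (n : ℝ) - q) :
    ((n : ℝ) - q) * orderStat x ⟨q - 1, by omega⟩
        + ∑ i, max (x i - orderStat x ⟨q - 1, by omega⟩) 0
      ≥ ∑ i, d i * x i := by
  generalize orderStat x ⟨q - 1, by omega⟩ = t
  rw [← hsum, Finset.sum_mul, ← Finset.sum_add_distrib]
  refine Finset.sum_le_sum fun i _ => ?_
  obtain ⟨h0, h1⟩ := hd i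
  have h2 := le_max_left (x i - t) 0
  have h3 := le_max_right (x i - t) 0
  nlinarith [mul_le_mul_of_nonneg_left h2 h0, mul_nonneg (sub_nonneg.2 h1) h3]
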